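/- arXiv:1403.2855 — 2 statements merged into one kernel-verified Lean document; each statement's English description precedes it below -/
import Mathlib

section
/- For every a ∈ SO(4), the 3×3 real matrices a₊ and a₋ (the matrices of ⋀²a restricted to Λ⁺ and Λ⁻ in the bases E⁺ and E⁻) both lie in SO(3), and the map ι : SO(4) → SO(3)×SO(3), ι(a) = (a₊, a₋), is a group homomorphism. -/
noncomputable section

open ExteriorAlgebra Matrix

/-- The standard basis vectors of `ℝ⁴`. -/
def ε (i : Fin 4) : Fin 4 → ℝ := Pi.single i 1

/-- The standard basis `E₁⁺, E₂⁺, E₃⁺` of the self-dual part `Λ⁺` of `⋀²ℝ⁴`. -/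
def Ep : Fin 3 → ExteriorAlgebra ℝ (Fin 4 → ℝ)
  | 0 => (Real.sqrt 2)⁻¹ • (ι ℝ (ε 0) * ι ℝ (ε 1) + ι ℝ (ε 2) * ι ℝ (ε 3))
  | 1 => (Real.sqrt 2)⁻¹ • (ι ℝ (ε 0) * ι ℝ (ε 2) + ι ℝ (ε 3) * ι ℝ (ε 1))
  | 2 => (Real.sqrt 2)⁻¹ • (ι ℝ (ε 0) * ι ℝ (ε 3) + ι ℝ (ε 1) * ι ℝ (ε 2))

/-- The standard basis `E₁⁻, E₂⁻, E₃⁻` of the anti-self-dual part `Λ⁻` of `⋀²ℝ⁴`. -/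
def Em : Fin 3 → ExteriorAlgebra ℝ (Fin 4 → ℝ)
  | 0 => (Real.sqrt 2)⁻¹ • (ι ℝ (ε 0) * ι ℝ (ε 1) - ι ℝ (ε 2) * ι ℝ (ε 3))
  | 1 => (Real.sqrt 2)⁻¹ • (ι ℝ (ε 0) * ι ℝ (ε 2) - ι ℝ (ε 3) * ι ℝ (ε 1))
  | 2 => (Real.sqrt 2)⁻¹ • (ι ℝ (ε 0) * ι ℝ (ε 3) - ι ℝ (ε 1) * ι ℝ (ε 2))

/-- `Λ⁺`, the span of `E₁⁺, E₂⁺, E₃⁺`. -/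
def ΛPlus : Submodule ℝ (ExteriorAlgebra ℝ (Fin 4 → ℝ)) :=
  Submodule.span ℝ (Set.range Ep)

/-- `Λ⁻`, the span of `E₁⁻, E₂⁻, E₃⁻`. -/
def ΛMinus : Submodule ℝ (ExteriorAlgebra ℝ (Fin 4 → ℝ)) :=
  Submodule.span ℝ (Set.range Em)

/-- `g` is the matrix of `⋀²a` restricted to `Λ⁺` in the basis `E⁺`:
`⋀²a (Eⱼ⁺) = Σᵢ gᵢⱼ Eᵢ⁺`. -/
def IsPlusMat (a : Matrix (Fin 4) (Fin 4) ℝ) (g : Matrix (Fin 3) (Fin 3) ℝ) : Prop :=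
  ∀ j, ExteriorAlgebra.map a.mulVecLin (Ep j) = ∑ i, g i j • Ep i

/-- `g` is the matrix of `⋀²a` restricted to `Λ⁻` in the basis `E⁻`:
`⋀²a (Eⱼ⁻) = Σᵢ gᵢⱼ Eᵢ⁻`. -/
def IsMinusMat (a : Matrix (Fin 4) (Fin 4) ℝ) (g : Matrix (Fin 3) (Fin 3) ℝ) : Prop :=
  ∀ j, ExteriorAlgebra.map a.mulVecLin (Em j) = ∑ i, g i j • Em i

def thetaF (p q : Fin 4) : ExteriorAlgebra ℝ (Fin 4 → ℝ) →ₗ[ℝ] ℝ :=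
  ExteriorAlgebra.liftAlternating (R := ℝ) (M := Fin 4 → ℝ) (N := ℝ)
    (fun i => if h : i = 2 then
      h ▸ ((Matrix.detRowAlternating (R := ℝ) (n := Fin 2)).compLinearMap
        (LinearMap.funLeft ℝ ℝ ![p, q])) else 0)

lemma thetaF_apply (p q : Fin 4) (x y : Fin 4 → ℝ) :
    thetaF p q (ExteriorAlgebra.ι ℝ x * ExteriorAlgebra.ι ℝ y) = x p * y q - x q * y p := by
  have h : ExteriorAlgebra.ι ℝ x * ExteriorAlgebra.ι ℝ y
      = ExteriorAlgebra.ιMulti ℝ 2 ![x, y] := by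
    simp [ExteriorAlgebra.ιMulti_apply]
  rw [h, thetaF, ExteriorAlgebra.liftAlternating_apply_ιMulti]
  simp [LinearMap.funLeft, Matrix.detRowAlternating]
  change Matrix.det (Matrix.of fun i => ![x, y] i ∘ ![p, q]) = _
  rw [Matrix.det_fin_two]
  simp

lemma c_ne : (Real.sqrt 2)⁻¹ ≠ 0 := by positivity

lemma Ep_inj (g h : Fin 3 → ℝ) (H : ∑ i, g i • Ep i = ∑ i, h i • Ep i) : g = h := by
  have key : ∀ (g : Fin 3 → ℝ) (k : Fin 3),
      thetaF 0 k.succ (∑ i, g i • Ep i) = g k * (Real.sqrt 2)⁻¹ := by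
    intro g k
    simp only [Fin.sum_univ_three, Ep, map_add, map_smul, thetaF_apply, ε]
    fin_cases k <;> simp
  funext k
  have := congrArg (thetaF 0 k.succ) H
  rw [key, key] at this
  exact mul_right_cancel₀ c_ne this

lemma Em_inj (g h : Fin 3 → ℝ) (H : ∑ i, g i • Em i = ∑ i, h i • Em i) : g = h := by
  have key : ∀ (g : Fin 3 → ℝ) (k : Fin 3),
      thetaF 0 k.succ (∑ i, g i • Em i) = g k * (Real.sqrt 2)⁻¹ := by
    intro g k
    simp only [Fin.sum_univ_three, Em, map_add, map_sub, map_smul, thetaF_apply, ε]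
    fin_cases k <;> simp
  funext k
  have := congrArg (thetaF 0 k.succ) H
  rw [key, key] at this
  exact mul_right_cancel₀ c_ne this

lemma hom_aux (E : Fin 3 → ExteriorAlgebra ℝ (Fin 4 → ℝ))
    (hE : ∀ g h : Fin 3 → ℝ, ∑ i, g i • E i = ∑ i, h i • E i → g = h)
    (a b : Matrix (Fin 4) (Fin 4) ℝ) (ga gb gab : Matrix (Fin 3) (Fin 3) ℝ)
    (ha : ∀ j, ExteriorAlgebra.map a.mulVecLin (E j) = ∑ i, ga i j • E i)
    (hb : ∀ j, ExteriorAlgebra.map b.mulVecLin (E j) = ∑ i, gb i j • E i)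
    (hab : ∀ j, ExteriorAlgebra.map (a * b).mulVecLin (E j) = ∑ i, gab i j • E i) :
    gab = ga * gb := by
  have h : ∀ j, (fun i => gab i j) = fun i => (ga * gb) i j := by
    intro j
    apply hE
    rw [← hab j, Matrix.mulVecLin_mul, ← ExteriorAlgebra.map_comp_map, AlgHom.comp_apply, hb j]
    simp only [map_sum, map_smul, ha, Matrix.mul_apply, Finset.smul_sum, Finset.sum_smul, smul_smul]
    rw [Finset.sum_comm]
    simp only [mul_comm]
  ext i j
  exact congrFun (h j) i

/-- The element of the exterior algebra attached to a matrix. -/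
def psiM : Matrix (Fin 4) (Fin 4) ℝ →ₗ[ℝ] ExteriorAlgebra ℝ (Fin 4 → ℝ) where
  toFun N := ∑ i, ∑ j, N i j • (ExteriorAlgebra.ι ℝ (ε i) * ExteriorAlgebra.ι ℝ (ε j))
  map_add' N N' := by simp [add_smul, Finset.sum_add_distrib]
  map_smul' c N := by simp [Finset.smul_sum, smul_smul]

lemma psiM_apply (N : Matrix (Fin 4) (Fin 4) ℝ) : psiM N =
  ∑ i, ∑ j, N i j • (ExteriorAlgebra.ι ℝ (ε i) * ExteriorAlgebra.ι ℝ (ε j)) := rfl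

lemma mulVec_eps (a : Matrix (Fin 4) (Fin 4) ℝ) (k : Fin 4) :
    a.mulVecLin (ε k) = ∑ i, a i k • ε i := by
  ext i
  simp [ε, Finset.sum_apply, Pi.single_apply]

lemma map_psiM (a N : Matrix (Fin 4) (Fin 4) ℝ) :
    ExteriorAlgebra.map a.mulVecLin (psiM N) = psiM (a * N * aᵀ) := by
  have h1 : ExteriorAlgebra.map a.mulVecLin (psiM N) = ∑ k, ∑ l, ∑ i, ∑ j,
      (a i k * N k l * a j l) • (ExteriorAlgebra.ι ℝ (ε i) * ExteriorAlgebra.ι ℝ (ε j)) := by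
    simp only [psiM_apply, map_sum, map_smul, map_mul, ExteriorAlgebra.map_apply_ι, mulVec_eps]
    refine Finset.sum_congr rfl fun k _ => Finset.sum_congr rfl fun l _ => ?_
    rw [Finset.sum_mul_sum, Finset.smul_sum]
    refine Finset.sum_congr rfl fun i _ => ?_
    rw [Finset.smul_sum]
    refine Finset.sum_congr rfl fun j _ => ?_
    rw [smul_mul_smul_comm, smul_smul]
    congr 1
    ring
  have h2 : psiM (a * N * aᵀ) = ∑ i, ∑ j, ∑ l, ∑ k,
      (a i k * N k l * a j l) • (ExteriorAlgebra.ι ℝ (ε i) * ExteriorAlgebra.ι ℝ (ε j)) := by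
    simp only [psiM_apply, Matrix.mul_apply, Matrix.transpose_apply, Finset.sum_mul,
      Finset.sum_smul]
  rw [h1, h2]
  calc _ = ∑ k, ∑ i, ∑ l, ∑ j, (a i k * N k l * a j l) •
          (ExteriorAlgebra.ι ℝ (ε i) * ExteriorAlgebra.ι ℝ (ε j)) :=
        Finset.sum_congr rfl fun k _ => Finset.sum_comm
    _ = ∑ i, ∑ k, ∑ l, ∑ j, (a i k * N k l * a j l) •
          (ExteriorAlgebra.ι ℝ (ε i) * ExteriorAlgebra.ι ℝ (ε j)) := Finset.sum_comm
    _ = ∑ i, ∑ k, ∑ j, ∑ l, (a i k * N k l * a j l) •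
          (ExteriorAlgebra.ι ℝ (ε i) * ExteriorAlgebra.ι ℝ (ε j)) :=
        Finset.sum_congr rfl fun i _ => Finset.sum_congr rfl fun k _ => Finset.sum_comm
    _ = ∑ i, ∑ j, ∑ k, ∑ l, (a i k * N k l * a j l) •
          (ExteriorAlgebra.ι ℝ (ε i) * ExteriorAlgebra.ι ℝ (ε j)) :=
        Finset.sum_congr rfl fun i _ => Finset.sum_comm
    _ = _ :=
        Finset.sum_congr rfl fun i _ => Finset.sum_congr rfl fun j _ => Finset.sum_comm

/-- quaternion matrices; sign `s` selects the chirality -/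
def JJ (s : ℝ) : Fin 3 → Matrix (Fin 4) (Fin 4) ℝ
  | 0 => !![0, 1, 0, 0; -1, 0, 0, 0; 0, 0, 0, s; 0, 0, -s, 0]
  | 1 => !![0, 0, 1, 0; 0, 0, 0, -s; -1, 0, 0, 0; 0, s, 0, 0]
  | 2 => !![0, 0, 0, 1; 0, 0, s, 0; 0, -s, 0, 0; -1, 0, 0, 0]

lemma anti (i j : Fin 4) : ExteriorAlgebra.ι ℝ (ε i) * ExteriorAlgebra.ι ℝ (ε j) =
    - (ExteriorAlgebra.ι ℝ (ε j) * ExteriorAlgebra.ι ℝ (ε i)) :=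
  eq_neg_of_add_eq_zero_left (ExteriorAlgebra.ι_add_mul_swap _ _)

lemma Ep_psi (j : Fin 3) : Ep j = psiM (((Real.sqrt 2)⁻¹ / 2) • JJ 1 j) := by
  rw [map_smul, psiM_apply]
  fin_cases j <;> simp [Ep, JJ, Fin.sum_univ_four]
  · rw [anti 1 0, anti 3 2]; module
  · rw [anti 2 0, anti 1 3]; module
  · rw [anti 3 0, anti 2 1]; module

lemma Em_psi (j : Fin 3) : Em j = psiM (((Real.sqrt 2)⁻¹ / 2) • JJ (-1) j) := by
  rw [map_smul, psiM_apply]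
  fin_cases j <;> simp [Em, JJ, Fin.sum_univ_four]
  · rw [anti 1 0, anti 3 2]; module
  · rw [anti 2 0, anti 1 3]; module
  · rw [anti 3 0, anti 2 1]; module

/-- Hodge star on skew matrices. -/
def starM (N : Matrix (Fin 4) (Fin 4) ℝ) : Matrix (Fin 4) (Fin 4) ℝ :=
  !![0, N 2 3, N 3 1, N 1 2; -N 2 3, 0, N 0 3, -N 0 2; -N 3 1, -N 0 3, 0, N 0 1;
     -N 1 2, N 0 2, -N 0 1, 0]

/-- A general skew matrix. -/
def skewM (x y z u v w : ℝ) : Matrix (Fin 4) (Fin 4) ℝ :=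
  !![0, x, y, z; -x, 0, u, v; -y, -u, 0, w; -z, -v, -w, 0]

lemma conj_entry (a : Matrix (Fin 4) (Fin 4) ℝ) (x y z u v w : ℝ) (p q : Fin 4) :
    (a * skewM x y z u v w * aᵀ) p q =
      x * (a p 0 * a q 1 - a p 1 * a q 0) + y * (a p 0 * a q 2 - a p 2 * a q 0)
      + z * (a p 0 * a q 3 - a p 3 * a q 0) + u * (a p 1 * a q 2 - a p 2 * a q 1)
      + v * (a p 1 * a q 3 - a p 3 * a q 1) + w * (a p 2 * a q 3 - a p 3 * a q 2) := by
  simp [Matrix.mul_apply, Fin.sum_univ_four, skewM]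
  ring

lemma det_four (a : Matrix (Fin 4) (Fin 4) ℝ) : a.det =
    (a 0 0 * a 1 1 - a 0 1 * a 1 0) * (a 2 2 * a 3 3 - a 2 3 * a 3 2)
    - (a 0 0 * a 1 2 - a 0 2 * a 1 0) * (a 2 1 * a 3 3 - a 2 3 * a 3 1)
    + (a 0 0 * a 1 3 - a 0 3 * a 1 0) * (a 2 1 * a 3 2 - a 2 2 * a 3 1)
    + (a 0 1 * a 1 2 - a 0 2 * a 1 1) * (a 2 0 * a 3 3 - a 2 3 * a 3 0)
    - (a 0 1 * a 1 3 - a 0 3 * a 1 1) * (a 2 0 * a 3 2 - a 2 2 * a 3 0)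
    + (a 0 2 * a 1 3 - a 0 3 * a 1 2) * (a 2 0 * a 3 1 - a 2 1 * a 3 0) := by
  rw [Matrix.det_succ_row_zero]
  simp [Fin.sum_univ_four, Matrix.det_fin_three, Matrix.submatrix_apply, Fin.succAbove]
  ring

lemma star_conj_gen (a : Matrix (Fin 4) (Fin 4) ℝ) (x y z u v w : ℝ) :
    aᵀ * starM (a * skewM x y z u v w * aᵀ) * a = a.det •
      !![0, w, -v, u; -w, 0, z, -y; v, -z, 0, x; -u, y, -x, 0] := by
  have hst : ∀ (M : Matrix (Fin 4) (Fin 4) ℝ) (p q : Fin 4), (aᵀ * starM M * a) p q =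
      M 2 3 * (a 0 p * a 1 q - a 1 p * a 0 q) + M 3 1 * (a 0 p * a 2 q - a 2 p * a 0 q)
      + M 1 2 * (a 0 p * a 3 q - a 3 p * a 0 q) + M 0 3 * (a 1 p * a 2 q - a 2 p * a 1 q)
      - M 0 2 * (a 1 p * a 3 q - a 3 p * a 1 q) + M 0 1 * (a 2 p * a 3 q - a 3 p * a 2 q) := by
    intro M p q
    simp [Matrix.mul_apply, Fin.sum_univ_four, starM]
    ring
  ext p q
  rw [hst, Matrix.smul_apply, det_four]
  simp only [conj_entry]
  fin_cases p <;> fin_cases q <;> simp <;> ring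

set_option maxHeartbeats 1000000 in
lemma JJ_anti (s : ℝ) (hs : s * s = 1) (i j : Fin 3) :
    JJ s i * JJ s j + JJ s j * JJ s i = (if i = j then (-2 : ℝ) else 0) • 1 := by
  fin_cases i <;> fin_cases j <;> ext p q <;> fin_cases p <;> fin_cases q <;>
    simp [JJ, hs] <;> norm_num

lemma star_conj (s : ℝ) (hs : s * s = 1) (j : Fin 3) (a : Matrix (Fin 4) (Fin 4) ℝ) :
    aᵀ * starM (a * JJ s j * aᵀ) * a = (a.det * s) • JJ s j := by
  fin_cases j
  · have hJ : JJ s 0 = skewM 1 0 0 0 0 s := by simp [JJ, skewM]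
    change aᵀ * starM (a * JJ s 0 * aᵀ) * a = (a.det * s) • JJ s 0
    rw [hJ, star_conj_gen]
    ext p q
    fin_cases p <;> fin_cases q <;> simp [skewM, mul_assoc, hs]
  · have hJ : JJ s 1 = skewM 0 1 0 0 (-s) 0 := by simp [JJ, skewM]
    change aᵀ * starM (a * JJ s 1 * aᵀ) * a = (a.det * s) • JJ s 1
    rw [hJ, star_conj_gen]
    ext p q
    fin_cases p <;> fin_cases q <;> simp [skewM, mul_assoc, hs]
  · have hJ : JJ s 2 = skewM 0 0 1 s 0 0 := by simp [JJ, skewM]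
    change aᵀ * starM (a * JJ s 2 * aᵀ) * a = (a.det * s) • JJ s 2
    rw [hJ, star_conj_gen]
    ext p q
    fin_cases p <;> fin_cases q <;> simp [skewM, mul_assoc, hs]

lemma JJ_mul (s : ℝ) (hs : s * s = 1) : JJ s 0 * JJ s 1 = (-s) • JJ s 2 := by
  ext i j
  fin_cases i <;> fin_cases j <;> simp [JJ, Matrix.mul_apply, Fin.sum_univ_four, hs]

set_option maxHeartbeats 1000000 in
lemma exists_mat (s : ℝ) (hs : s * s = 1) (a : Matrix (Fin 4) (Fin 4) ℝ) (ha : aᵀ * a = 1)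
    (hd : a.det = 1) : ∃ g : Matrix (Fin 3) (Fin 3) ℝ,
      (∀ j, a * JJ s j * aᵀ = ∑ i, g i j • JJ s i) ∧ gᵀ * g = 1 ∧ g.det = 1 := by
  have ha' : a * aᵀ = 1 := mul_eq_one_comm.mp ha
  have hstar : ∀ j, starM (a * JJ s j * aᵀ) = s • (a * JJ s j * aᵀ) := by
    intro j
    have h := star_conj s hs j a
    rw [hd, one_mul] at h
    calc starM (a * JJ s j * aᵀ) = (a * aᵀ) * starM (a * JJ s j * aᵀ) * (a * aᵀ) := by
          rw [ha']; simp
      _ = a * (aᵀ * starM (a * JJ s j * aᵀ) * a) * aᵀ := by simp only [Matrix.mul_assoc]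
      _ = _ := by rw [h]; simp
  let g : Matrix (Fin 3) (Fin 3) ℝ := fun i j => (a * JJ s j * aᵀ) 0 i.succ
  have hg : ∀ j, a * JJ s j * aᵀ = ∑ i, g i j • JJ s i := by
    intro j
    have e : ∀ p q, starM (a * JJ s j * aᵀ) p q = s * (a * JJ s j * aᵀ) p q := by
      intro p q; rw [hstar]; simp
    have e' : ∀ p q, (a * JJ s j * aᵀ) p q = s * starM (a * JJ s j * aᵀ) p q := by
      intro p q; rw [e, ← mul_assoc, hs, one_mul]
    simp only [g]
    generalize a * JJ s j * aᵀ = M at *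
    ext p q
    rw [e' p q]
    have e1 := e 0 1
    have e2 := e 0 2
    have e3 := e 0 3
    have hss : ∀ x : ℝ, s * (s * x) = x := by intro x; rw [← mul_assoc, hs, one_mul]
    simp [starM] at e1 e2 e3
    fin_cases p <;> fin_cases q <;>
      simp [starM, JJ, Fin.sum_univ_three, e1, e2, e3, hss] <;> ring
  have hmul : ∀ i j, (a * JJ s i * aᵀ) * (a * JJ s j * aᵀ) = a * (JJ s i * JJ s j) * aᵀ := by
    intro i j
    calc _ = a * JJ s i * (aᵀ * a) * (JJ s j * aᵀ) := by simp only [Matrix.mul_assoc]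
      _ = _ := by rw [ha]; simp only [Matrix.mul_assoc, Matrix.mul_one, Matrix.one_mul]
  clear_value g
  have hanti : ∀ i j, (a * JJ s i * aᵀ) * (a * JJ s j * aᵀ)
      + (a * JJ s j * aᵀ) * (a * JJ s i * aᵀ) = (if i = j then (-2 : ℝ) else 0) • 1 := by
    intro i j
    rw [hmul, hmul, ← Matrix.add_mul, ← Matrix.mul_add, JJ_anti s hs]
    simp [ha']
  have horth : gᵀ * g = 1 := by
    ext i j
    have h := congrFun (congrFun (hanti i j) 0) 0
    rw [hg, hg] at h
    simp [Matrix.mul_apply, Fin.sum_univ_four, Fin.sum_univ_three, JJ] at h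
    simp only [Matrix.mul_apply, Matrix.transpose_apply, Fin.sum_univ_three, Matrix.one_apply]
    split_ifs at h ⊢ <;> linarith
  refine ⟨g, hg, horth, ?_⟩
  have h3 := hmul 0 1
  rw [JJ_mul s hs, Matrix.mul_smul, Matrix.smul_mul, hg, hg, hg] at h3
  have c1 := congrFun (congrFun h3 0) 1
  have c2 := congrFun (congrFun h3 0) 2
  have c3 := congrFun (congrFun h3 0) 3
  simp [Matrix.mul_apply, Fin.sum_univ_four, Fin.sum_univ_three, JJ] at c1 c2 c3
  have o := congrFun (congrFun horth 2) 2
  simp [Matrix.mul_apply, Fin.sum_univ_three] at o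
  have d1 : g 1 0 * g 2 1 - g 2 0 * g 1 1 = g 0 2 := by
    linear_combination (-s) * c1 + (g 0 2 - (g 1 0 * g 2 1 - g 2 0 * g 1 1)) * hs
  have d2 : g 2 0 * g 0 1 - g 0 0 * g 2 1 = g 1 2 := by
    linear_combination (-s) * c2 + (g 1 2 - (g 2 0 * g 0 1 - g 0 0 * g 2 1)) * hs
  have d3 : g 0 0 * g 1 1 - g 1 0 * g 0 1 = g 2 2 := by
    linear_combination (-s) * c3 + (g 2 2 - (g 0 0 * g 1 1 - g 1 0 * g 0 1)) * hs
  rw [Matrix.det_fin_three]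
  linear_combination g 0 2 * d1 + g 1 2 * d2 + g 2 2 * d3 + o

/-- For every `a ∈ SO(4)` the matrices `a₊` and `a₋` of `⋀²a` on `Λ⁺` and `Λ⁻` exist and
lie in `SO(3)`, and the map `ι(a) = (a₊, a₋)` is a group homomorphism:
`(ab)₊ = a₊ b₊` and `(ab)₋ = a₋ b₋`. -/
theorem iota_into_SO3_SO3_hom :
    (∀ a : Matrix (Fin 4) (Fin 4) ℝ, aᵀ * a = 1 → a.det = 1 →
      ∃ ap am : Matrix (Fin 3) (Fin 3) ℝ,
        IsPlusMat a ap ∧ IsMinusMat a am ∧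
        apᵀ * ap = 1 ∧ ap.det = 1 ∧ amᵀ * am = 1 ∧ am.det = 1) ∧
    (∀ a b : Matrix (Fin 4) (Fin 4) ℝ, aᵀ * a = 1 → a.det = 1 → bᵀ * b = 1 → b.det = 1 →
      ∀ apa ama apb amb apab amab : Matrix (Fin 3) (Fin 3) ℝ,
        IsPlusMat a apa → IsMinusMat a ama →
        IsPlusMat b apb → IsMinusMat b amb →
        IsPlusMat (a * b) apab → IsMinusMat (a * b) amab →
        apab = apa * apb ∧ amab = ama * amb) := by
  refine ⟨?_, ?_⟩
  · intro a ha hd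
    obtain ⟨ap, h1, h2, h3⟩ := exists_mat 1 (by norm_num) a ha hd
    obtain ⟨am, k1, k2, k3⟩ := exists_mat (-1) (by norm_num) a ha hd
    refine ⟨ap, am, ?_, ?_, h2, h3, k2, k3⟩
    · intro j
      simp only [Ep_psi]
      rw [map_psiM, Matrix.mul_smul, Matrix.smul_mul, h1]
      simp only [Finset.smul_sum, map_sum, map_smul]
      exact Finset.sum_congr rfl fun i _ => smul_comm _ _ _
    · intro j
      simp only [Em_psi]
      rw [map_psiM, Matrix.mul_smul, Matrix.smul_mul, k1]
      simp only [Finset.smul_sum, map_sum, map_smul]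
      exact Finset.sum_congr rfl fun i _ => smul_comm _ _ _
  · intro a b _ _ _ _ apa ama apb amb apab amab h1 h2 h3 h4 h5 h6
    exact ⟨hom_aux Ep Ep_inj a b _ _ _ h1 h3 h5, hom_aux Em Em_inj a b _ _ _ h2 h4 h6⟩
end
end

section
/- Let A be a 3×3 real symmetric matrix. Then the (1,2)-entry and the (1,3)-entry of gᵀAg vanish for every g ∈ SO(3) if and only if A is a scalar multiple of the identity matrix, i.e., A = c·I₃ for some real number c. -/
open Matrix

/-- A `3×3` real symmetric matrix `A` has vanishing `(1,2)`- and `(1,3)`-entries of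
`gᵀAg` for every `g ∈ SO(3)` if and only if `A` is a scalar multiple of the identity. -/
theorem symm_entries_vanish_iff_scalar (A : Matrix (Fin 3) (Fin 3) ℝ) (hA : Aᵀ = A) :
    (∀ g : Matrix (Fin 3) (Fin 3) ℝ, gᵀ * g = 1 → g.det = 1 →
      (gᵀ * A * g) 0 1 = 0 ∧ (gᵀ * A * g) 0 2 = 0) ↔
    ∃ c : ℝ, A = c • (1 : Matrix (Fin 3) (Fin 3) ℝ) := by
  constructor
  · intro h
    have s (i j) : A j i = A i j := congrFun (congrFun hA i) j
    have s1 := s 0 1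
    have s2 := s 0 2
    have s3 := s 1 2
    obtain ⟨h1, h2⟩ := h 1 (by simp) (by simp)
    simp only [transpose_one, one_mul, mul_one] at h1 h2
    have h3 := (h !![0,0,1;1,0,0;0,1,0]
      (by ext i j; fin_cases i <;> fin_cases j <;> simp [Matrix.mul_apply, Fin.sum_univ_three])
      (by simp [Matrix.det_fin_three])).1
    have h4 := (h !![3/5,-4/5,0;4/5,3/5,0;0,0,1]
      (by ext i j; fin_cases i <;> fin_cases j <;>
            simp [Matrix.mul_apply, Fin.sum_univ_three] <;> norm_num)
      (by simp [Matrix.det_fin_three] <;> norm_num)).1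
    have h5 := (h !![3/5,0,-4/5;0,1,0;4/5,0,3/5]
      (by ext i j; fin_cases i <;> fin_cases j <;>
            simp [Matrix.mul_apply, Fin.sum_univ_three] <;> norm_num)
      (by simp [Matrix.det_fin_three] <;> norm_num)).2
    simp [Matrix.mul_apply, Fin.sum_univ_three] at h3 h4 h5
    refine ⟨A 0 0, ?_⟩
    ext i j
    fin_cases i <;> fin_cases j <;> simp <;> linarith
  · rintro ⟨c, rfl⟩ g hg _
    simp [hg]
end
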